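/- Let Q be a cube in ℝ^n with sides parallel to the axes and let p₀ satisfy 0 < p₀ < ∞. Then the following three sets of measurable functions on Q coincide: (1) the union over r > 0 of 𝓜^r_{A₁}(Q); (2) the union over p > 0 of L^p(Q); (3) the union over w ∈ A_∞(Q) of L^{p₀}_w(Q). -/

import Mathlib

open MeasureTheory ENNReal

/-- A (nondegenerate) cube in `ℝⁿ` with sides parallel to the axes. -/
def IsCube {n : ℕ} (Q : Set (Fin n → ℝ)) : Prop :=
  ∃ (a : Fin n → ℝ) (l : ℝ), 0 < l ∧
    Q = Set.univ.pi fun i => Set.Icc (a i) (a i + l)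

/-- The domains considered: all of `ℝⁿ` or a cube with sides parallel to the axes. -/
def IsAdmissibleDomain {n : ℕ} (Ω : Set (Fin n → ℝ)) : Prop :=
  Ω = Set.univ ∨ IsCube Ω

/-- The Hardy–Littlewood maximal operator restricted to `Ω`:
`M_Ω f (x) = sup { (1/|Q|) ∫_Q |f| : Q ⊆ Ω a cube with x ∈ Q }`. -/
noncomputable def maximal {n : ℕ} (Ω : Set (Fin n → ℝ)) (f : (Fin n → ℝ) → ℝ)
    (x : Fin n → ℝ) : ℝ≥0∞ :=
  ⨆ (Q : Set (Fin n → ℝ)) (_ : IsCube Q) (_ : Q ⊆ Ω) (_ : x ∈ Q),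
    (volume Q)⁻¹ * ∫⁻ y in Q, ENNReal.ofReal |f y|

/-- A weight on `Ω`: a measurable function, positive a.e. on `Ω`, integrable on every
cube contained in `Ω` (hence locally integrable; integrable when `Ω` is itself a cube). -/
structure IsWeight {n : ℕ} (Ω : Set (Fin n → ℝ)) (w : (Fin n → ℝ) → ℝ) : Prop where
  measurable : Measurable w
  pos : ∀ᵐ x ∂(volume.restrict Ω), 0 < w x
  locInt : ∀ Q : Set (Fin n → ℝ), IsCube Q → Q ⊆ Ω → IntegrableOn w Q

/-- The Muckenhoupt `A₁(Ω)` class: `M_Ω w ≤ C w` a.e. on `Ω`. -/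
def MemA1 {n : ℕ} (Ω : Set (Fin n → ℝ)) (w : (Fin n → ℝ) → ℝ) : Prop :=
  IsWeight Ω w ∧ ∃ C : ℝ, ∀ᵐ x ∂(volume.restrict Ω),
    maximal Ω w x ≤ ENNReal.ofReal (C * w x)

/-- The Muckenhoupt `A_p(Ω)` class for `1 < p < ∞`:
`sup_{Q ⊆ Ω} (avg_Q w) * (avg_Q w^(1-p'))^(p-1) < ∞` where `p' = p/(p-1)`. -/
def MemApGT1 {n : ℕ} (Ω : Set (Fin n → ℝ)) (p : ℝ) (w : (Fin n → ℝ) → ℝ) : Prop :=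
  IsWeight Ω w ∧ ∃ C : ℝ≥0∞, C ≠ ∞ ∧ ∀ Q : Set (Fin n → ℝ), IsCube Q → Q ⊆ Ω →
    ((volume Q)⁻¹ * ∫⁻ x in Q, ENNReal.ofReal (w x)) *
      ((volume Q)⁻¹ * ∫⁻ x in Q, ENNReal.ofReal (w x ^ (1 - p / (p - 1)))) ^ (p - 1) ≤ C

/-- The Muckenhoupt `A_p(Ω)` class for `1 ≤ p < ∞`. -/
def MemA {n : ℕ} (Ω : Set (Fin n → ℝ)) (p : ℝ) (w : (Fin n → ℝ) → ℝ) : Prop :=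
  (p = 1 ∧ MemA1 Ω w) ∨ (1 < p ∧ MemApGT1 Ω p w)

/-- The Muckenhoupt `A_∞(Ω)` class: the union of `A_p(Ω)` over `1 ≤ p < ∞`. -/
def MemAInf {n : ℕ} (Ω : Set (Fin n → ℝ)) (w : (Fin n → ℝ) → ℝ) : Prop :=
  ∃ p : ℝ, 1 ≤ p ∧ MemA Ω p w

/-- Membership in the weighted Lebesgue space `L^p_w(Ω)`: `f` measurable with
`∫_Ω |f|^p w < ∞`. -/
def MemLw {n : ℕ} (Ω : Set (Fin n → ℝ)) (p : ℝ) (w f : (Fin n → ℝ) → ℝ) : Prop :=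
  Measurable f ∧
    ∫⁻ x in Ω, ENNReal.ofReal |f x| ^ p * ENNReal.ofReal (w x) < ⊤

/-- Membership in the (unweighted) Lebesgue space `L^p(Ω)`. -/
def MemLeb {n : ℕ} (Ω : Set (Fin n → ℝ)) (p : ℝ) (f : (Fin n → ℝ) → ℝ) : Prop :=
  MemLw Ω p (fun _ => 1) f

/-- `f ∈ 𝓜_{A_p}(Ω)`: `f` is measurable and `|f| ≤ w` a.e. on `Ω` for some `w ∈ A_p(Ω)`. -/
def HasApMajorant {n : ℕ} (Ω : Set (Fin n → ℝ)) (p : ℝ) (f : (Fin n → ℝ) → ℝ) : Prop :=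
  Measurable f ∧ ∃ w, MemA Ω p w ∧ ∀ᵐ x ∂(volume.restrict Ω), |f x| ≤ w x

/-- `f ∈ 𝓜^r_{A_p}(Ω)`: `f` is measurable and `|f|^r ≤ w` a.e. on `Ω` for some
`w ∈ A_p(Ω)`. -/
def HasApPowMajorant {n : ℕ} (Ω : Set (Fin n → ℝ)) (p r : ℝ) (f : (Fin n → ℝ) → ℝ) : Prop :=
  Measurable f ∧ ∃ w, MemA Ω p w ∧ ∀ᵐ x ∂(volume.restrict Ω), |f x| ^ r ≤ w x

/-- `f ∈ 𝓜_{A_∞}(Ω)`: `f` is measurable and `|f| ≤ w` a.e. on `Ω` for some `w ∈ A_∞(Ω)`. -/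
def HasAInfMajorant {n : ℕ} (Ω : Set (Fin n → ℝ)) (f : (Fin n → ℝ) → ℝ) : Prop :=
  Measurable f ∧ ∃ w, MemAInf Ω w ∧ ∀ᵐ x ∂(volume.restrict Ω), |f x| ≤ w x

/-- Membership in weak `L^p(ℝⁿ)`: `sup_{t>0} t · |{|f| > t}|^{1/p} < ∞`. -/
def MemWeakLp {n : ℕ} (p : ℝ) (f : (Fin n → ℝ) → ℝ) : Prop :=
  Measurable f ∧ ∃ C : ℝ≥0∞, C ≠ ⊤ ∧ ∀ t : ℝ, 0 < t →
    ENNReal.ofReal t * volume {x | t < |f x|} ^ (1 / p) ≤ C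

/-- The uncentred maximal function on `ℝⁿ` (with the sup norm) in which a closed ball is tested
only at the points of its interior; this makes it lower semicontinuous. -/
noncomputable def ballMaximal {n : ℕ} (g : (Fin n → ℝ) → ℝ≥0∞) (x : Fin n → ℝ) : ℝ≥0∞ :=
  ⨆ (c : Fin n → ℝ) (ρ : ℝ) (_ : x ∈ Metric.ball c ρ),
    (volume (Metric.closedBall c ρ))⁻¹ * ∫⁻ y in Metric.closedBall c ρ, g y

lemma lt_ballMaximal_iff {n : ℕ} {g : (Fin n → ℝ) → ℝ≥0∞} {t : ℝ≥0∞} {x : Fin n → ℝ} :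
    t < ballMaximal g x ↔ ∃ c ρ, x ∈ Metric.ball c ρ ∧
      t < (volume (Metric.closedBall c ρ))⁻¹ * ∫⁻ y in Metric.closedBall c ρ, g y := by
  simp only [ballMaximal, lt_iSup_iff, exists_prop]

lemma measurable_ballMaximal {n : ℕ} (g : (Fin n → ℝ) → ℝ≥0∞) : Measurable (ballMaximal g) := by
  refine measurable_of_Ioi fun t => IsOpen.measurableSet ?_
  have : ballMaximal g ⁻¹' Set.Ioi t = ⋃ (c : Fin n → ℝ) (ρ : ℝ)
      (_ : t < (volume (Metric.closedBall c ρ))⁻¹ * ∫⁻ y in Metric.closedBall c ρ, g y),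
        Metric.ball c ρ := by
    ext x
    simp only [Set.mem_preimage, Set.mem_Ioi, lt_ballMaximal_iff, Set.mem_iUnion, exists_prop,
      and_comm]
  rw [this]
  exact isOpen_iUnion fun c => isOpen_iUnion fun ρ => isOpen_iUnion fun _ => Metric.isOpen_ball

lemma volume_closedBall_mul {n : ℕ} (c c' : Fin n → ℝ) {τ ρ : ℝ} (hτ : 0 ≤ τ) (hρ : 0 ≤ ρ) :
    volume (Metric.closedBall c (τ * ρ)) =
      ENNReal.ofReal τ ^ n * volume (Metric.closedBall c' ρ) := by
  rw [Measure.addHaar_closedBall_mul _ c hτ hρ, Measure.addHaar_closedBall_center _ c' ρ,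
    Module.finrank_fin_fun, ENNReal.ofReal_pow hτ]

lemma volume_closedBall_ne_zero {n : ℕ} (c : Fin n → ℝ) {ρ : ℝ} (hρ : 0 < ρ) :
    volume (Metric.closedBall c ρ) ≠ 0 := (Metric.measure_closedBall_pos _ _ hρ).ne'

lemma volume_closedBall_ne_top {n : ℕ} (c : Fin n → ℝ) (ρ : ℝ) :
    volume (Metric.closedBall c ρ) ≠ ∞ := measure_closedBall_lt_top.ne

lemma setLIntegral_le_ballMaximal {n : ℕ} (g : (Fin n → ℝ) → ℝ≥0∞) {x c : Fin n → ℝ} {ρ : ℝ}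
    (hx : x ∈ Metric.ball c ρ) :
    ∫⁻ y in Metric.closedBall c ρ, g y ≤ volume (Metric.closedBall c ρ) * ballMaximal g x := by
  have hρ : 0 < ρ := Metric.pos_of_mem_ball hx
  rw [← ENNReal.inv_mul_le_iff (volume_closedBall_ne_zero c hρ) (volume_closedBall_ne_top c ρ)]
  exact le_iSup₂_of_le c ρ (le_iSup_of_le hx le_rfl)

lemma le_of_exists_closedBall {n : ℕ} {g : (Fin n → ℝ) → ℝ≥0∞} {t : ℝ≥0∞}
    {E S : Set (Fin n → ℝ)} {R : ℝ}
    (h : ∀ y ∈ E, ∃ c ρ, 0 < ρ ∧ ρ ≤ R ∧ y ∈ Metric.closedBall c ρ ∧ Metric.closedBall c ρ ⊆ S ∧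
      t * volume (Metric.closedBall c ρ) ≤ ∫⁻ z in Metric.closedBall c ρ, g z) :
    t * volume E ≤ 5 ^ n * ∫⁻ z in S, g z := by
  choose! c ρ hρ hR hy hS ht using h
  obtain ⟨u, huE, hdisj, hcov⟩ := Vitali.exists_disjoint_subfamily_covering_enlargement_closedBall
    E c ρ R hR 5 (by norm_num)
  have hcount : u.Countable := hdisj.countable_of_nonempty_interior fun i hi =>
    ⟨c i, Metric.ball_subset_interior_closedBall (Metric.mem_ball_self (hρ i (huE hi)))⟩
  have : Countable u := hcount.to_subtype
  have hEsub : E ⊆ ⋃ i : u, Metric.closedBall (c i) (5 * ρ i) := by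
    intro y hyE
    obtain ⟨b, hb, hsub⟩ := hcov y hyE
    exact Set.mem_iUnion.2 ⟨⟨b, hb⟩, hsub (hy y hyE)⟩
  calc t * volume E ≤ t * ∑' i : u, volume (Metric.closedBall (c i) (5 * ρ i)) := by
        gcongr
        exact (measure_mono hEsub).trans (measure_iUnion_le _)
    _ = ∑' i : u, 5 ^ n * (t * volume (Metric.closedBall (c i) (ρ i))) := by
        rw [← ENNReal.tsum_mul_left]
        refine tsum_congr fun i => ?_
        rw [volume_closedBall_mul _ (c i) (by norm_num) (hρ i (huE i.2)).le]
        simp only [ENNReal.ofReal_ofNat]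
        ring
    _ ≤ ∑' i : u, 5 ^ n * ∫⁻ z in Metric.closedBall (c i) (ρ i), g z := by
        gcongr with i
        exact ht i (huE i.2)
    _ = 5 ^ n * ∫⁻ z in ⋃ i : u, Metric.closedBall (c i) (ρ i), g z := by
        rw [ENNReal.tsum_mul_left, lintegral_iUnion (fun i => measurableSet_closedBall)]
        exact fun i j hij => hdisj i.2 j.2 fun h => hij (Subtype.ext h)
    _ ≤ _ := by
        gcongr
        exact Set.iUnion_subset fun i => hS i (huE i.2)

lemma rpow_half_le_add_tsum_indicator {b z : ℝ≥0∞} (hb : b ≠ 0) (hz : z ≠ ∞) :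
    z ^ (1 / 2 : ℝ) ≤ b ^ (1 / 2 : ℝ) +
      ∑' k : ℕ, {y : ℝ≥0∞ | 4 ^ k * b < y}.indicator (fun _ => 2 ^ (k + 1) * b ^ (1 / 2 : ℝ)) z := by
  have h4 : ∀ m : ℕ, ((4 : ℝ≥0∞) ^ m * b) ^ (1 / 2 : ℝ) = 2 ^ m * b ^ (1 / 2 : ℝ) := by
    intro m
    rw [ENNReal.mul_rpow_of_nonneg _ _ (by norm_num), show (4 : ℝ≥0∞) = 2 ^ 2 by norm_num,
      ← pow_mul, mul_comm 2 m, pow_mul, ← ENNReal.rpow_natCast (2 ^ m) 2, ← ENNReal.rpow_mul]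
    norm_num
  have hex : ∃ m : ℕ, z ≤ 4 ^ m * b := by
    obtain ⟨m, hm⟩ := ENNReal.exists_nat_mul_gt hb hz
    refine ⟨m, hm.le.trans ?_⟩
    gcongr
    exact_mod_cast (Nat.lt_pow_self (by norm_num : 1 < 4)).le
  classical
  obtain h0 | ⟨k, hk⟩ : Nat.find hex = 0 ∨ ∃ k, Nat.find hex = k + 1 := by
    cases Nat.find hex <;> simp
  · have := Nat.find_spec hex
    rw [h0, pow_zero, one_mul] at this
    exact (ENNReal.rpow_le_rpow this (by norm_num)).trans le_self_add
  · have h1 := Nat.find_spec hex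
    have h2 := Nat.find_min hex (m := k) (by omega)
    rw [hk] at h1
    refine le_add_left (le_trans ?_ (ENNReal.le_tsum k))
    rw [Set.indicator_of_mem (by simpa using h2), ← h4]
    exact ENNReal.rpow_le_rpow h1 (by norm_num)

lemma lintegral_rpow_half_le {α : Type*} [MeasurableSpace α] {μ : Measure α} {ψ : α → ℝ≥0∞}
    {b : ℝ≥0∞} (hb : b ≠ 0) (hψ : Measurable ψ) (hfin : ∀ᵐ x ∂μ, ψ x ≠ ∞)
    (h : ∀ k : ℕ, 4 ^ k * μ {x | 4 ^ k * b < ψ x} ≤ μ Set.univ) :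
    ∫⁻ x, ψ x ^ (1 / 2 : ℝ) ∂μ ≤ 5 * (b ^ (1 / 2 : ℝ) * μ Set.univ) := by
  have hms : ∀ k : ℕ, MeasurableSet {x | 4 ^ k * b < ψ x} := fun k => hψ measurableSet_Ioi
  have hterm : ∀ k : ℕ, 2 ^ (k + 1) * b ^ (1 / 2 : ℝ) * μ {x | 4 ^ k * b < ψ x} ≤
      2 * (b ^ (1 / 2 : ℝ) * μ Set.univ) * 2⁻¹ ^ k := by
    intro k
    have : (2 : ℝ≥0∞) ^ k * μ {x | 4 ^ k * b < ψ x} ≤ 2⁻¹ ^ k * μ Set.univ := by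
      have h2 : (2 : ℝ≥0∞) ^ k * 2⁻¹ ^ k = 1 := by
        rw [← mul_pow, ENNReal.mul_inv_cancel (by norm_num) (by norm_num), one_pow]
      calc (2 : ℝ≥0∞) ^ k * μ {x | 4 ^ k * b < ψ x}
          = 2⁻¹ ^ k * (4 ^ k * μ {x | 4 ^ k * b < ψ x}) := by
            rw [show (4 : ℝ≥0∞) = 2 * 2 by norm_num, mul_pow]
            calc _ = (2 ^ k * 2⁻¹ ^ k) * (2 ^ k * μ {x | 2 ^ k * 2 ^ k * b < ψ x}) := by
                  rw [h2, one_mul, ← mul_pow]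
              _ = _ := by ring
        _ ≤ _ := by gcongr; exact h k
    calc 2 ^ (k + 1) * b ^ (1 / 2 : ℝ) * μ {x | 4 ^ k * b < ψ x}
        = 2 * b ^ (1 / 2 : ℝ) * (2 ^ k * μ {x | 4 ^ k * b < ψ x}) := by ring
      _ ≤ 2 * b ^ (1 / 2 : ℝ) * (2⁻¹ ^ k * μ Set.univ) := by gcongr
      _ = _ := by ring
  calc ∫⁻ x, ψ x ^ (1 / 2 : ℝ) ∂μ
      ≤ ∫⁻ x, b ^ (1 / 2 : ℝ) + ∑' k : ℕ, {x | 4 ^ k * b < ψ x}.indicator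
          (fun _ => 2 ^ (k + 1) * b ^ (1 / 2 : ℝ)) x ∂μ :=
        lintegral_mono_ae (hfin.mono fun x hx => rpow_half_le_add_tsum_indicator hb hx)
    _ = b ^ (1 / 2 : ℝ) * μ Set.univ +
          ∑' k : ℕ, 2 ^ (k + 1) * b ^ (1 / 2 : ℝ) * μ {x | 4 ^ k * b < ψ x} := by
        rw [lintegral_add_left measurable_const, lintegral_const, lintegral_tsum fun k =>
          (measurable_const.indicator (hms k)).aemeasurable]
        simp only [lintegral_indicator (hms _), setLIntegral_const]
    _ ≤ b ^ (1 / 2 : ℝ) * μ Set.univ +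
          ∑' k : ℕ, 2 * (b ^ (1 / 2 : ℝ) * μ Set.univ) * 2⁻¹ ^ k :=
        add_le_add le_rfl (ENNReal.tsum_le_tsum hterm)
    _ = _ := by
        rw [ENNReal.tsum_mul_left, ENNReal.tsum_geometric_two]
        ring

/-- The Coifman–Rochberg estimate with exponent `1 / 2`. -/
lemma exists_setLIntegral_ballMaximal_rpow_half_le (n : ℕ) :
    ∃ K : ℝ≥0∞, K ≠ ∞ ∧ ∀ (g : (Fin n → ℝ) → ℝ≥0∞) (c x : Fin n → ℝ) (r : ℝ), 0 < r →
      x ∈ Metric.closedBall c r → ballMaximal g x ≠ 0 → (∀ᵐ y, ballMaximal g y ≠ ∞) →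
      ∫⁻ y in Metric.closedBall c r, ballMaximal g y ^ (1 / 2 : ℝ) ≤
        volume (Metric.closedBall c r) * (K * ballMaximal g x ^ (1 / 2 : ℝ)) := by
  refine ⟨5 * (15 ^ n) ^ (1 / 2 : ℝ), by finiteness, fun g c x r hr hx h0 hfin => ?_⟩
  set B := Metric.closedBall c r with hB
  set a := ballMaximal g x with ha
  have key : ∀ k : ℕ, 4 ^ k * (volume.restrict B) {y | 4 ^ k * (15 ^ n * a) < ballMaximal g y} ≤
      (volume.restrict B) Set.univ := by
    intro k
    by_cases hatop : a = ∞
    · simp [hatop]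
    have hmeas : MeasurableSet {y | 4 ^ k * (15 ^ n * a) < ballMaximal g y} :=
      measurable_ballMaximal g measurableSet_Ioi
    rw [Measure.restrict_apply hmeas,
      Measure.restrict_apply_univ]
    set E := {y | 4 ^ k * (15 ^ n * a) < ballMaximal g y} ∩ B with hE
    have hweak : 4 ^ k * (15 ^ n * a) * volume E ≤
        5 ^ n * ∫⁻ z in Metric.closedBall c (3 * r), g z := by
      refine le_of_exists_closedBall (R := r) fun y hy => ?_
      obtain ⟨c', ρ, hyρ, hlt⟩ := lt_ballMaximal_iff.1 hy.1
      have hρ : 0 < ρ := Metric.pos_of_mem_ball hyρ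
      have hyB := hy.2
      rw [hB, Metric.mem_closedBall] at hyB
      rw [Metric.mem_closedBall] at hx
      rw [Metric.mem_ball] at hyρ
      have hρr : ρ ≤ r := by
        by_contra! hlt'
        have hx3 : x ∈ Metric.ball c' (3 * ρ) := by
          rw [Metric.mem_ball]
          have h1 := dist_triangle x c c'
          have h2 := dist_triangle c y c'
          rw [dist_comm c y] at h2
          linarith
        have h3 := setLIntegral_le_ballMaximal g hx3
        rw [volume_closedBall_mul c' c' (by norm_num) hρ.le] at h3
        refine absurd hlt (not_lt.2 ?_)
        rw [ENNReal.inv_mul_le_iff (volume_closedBall_ne_zero c' hρ)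
          (volume_closedBall_ne_top c' ρ)]
        calc ∫⁻ z in Metric.closedBall c' ρ, g z
            ≤ ∫⁻ z in Metric.closedBall c' (3 * ρ), g z :=
              lintegral_mono_set (Metric.closedBall_subset_closedBall (by linarith))
          _ ≤ _ := h3
          _ = volume (Metric.closedBall c' ρ) * (1 * (3 ^ n * a)) := by
              simp only [ENNReal.ofReal_ofNat]
              ring
          _ ≤ _ := by
              gcongr
              · exact one_le_pow₀ (by norm_num)
              · norm_num
      refine ⟨c', ρ, hρ, hρr, hyρ.le, Metric.closedBall_subset_closedBall' ?_, ?_⟩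
      · have h2 := dist_triangle c' y c
        rw [dist_comm c' y] at h2
        linarith
      · have := hlt.le
        rwa [mul_comm (volume _)⁻¹, ← div_eq_mul_inv, ENNReal.le_div_iff_mul_le
          (Or.inl (volume_closedBall_ne_zero c' hρ))
          (Or.inl (volume_closedBall_ne_top c' ρ))] at this
    have hx3 : x ∈ Metric.ball c (3 * r) := by
      rw [Metric.mem_ball]
      rw [Metric.mem_closedBall] at hx
      linarith
    have hlarge := setLIntegral_le_ballMaximal g hx3
    rw [volume_closedBall_mul c c (by norm_num) hr.le] at hlarge
    have hfac0 : (15 : ℝ≥0∞) ^ n * a ≠ 0 := mul_ne_zero (by positivity) h0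
    have hfact : (15 : ℝ≥0∞) ^ n * a ≠ ∞ := by finiteness
    rw [← ENNReal.mul_le_mul_iff_right hfac0 hfact]
    calc 15 ^ n * a * (4 ^ k * volume E) = 4 ^ k * (15 ^ n * a) * volume E := by ring
      _ ≤ _ := hweak
      _ ≤ 5 ^ n * (ENNReal.ofReal 3 ^ n * volume B * a) := by gcongr
      _ = 15 ^ n * a * volume B := by
          rw [show (15 : ℝ≥0∞) = 5 * 3 by norm_num, mul_pow]
          simp only [ENNReal.ofReal_ofNat]
          ring
  have := lintegral_rpow_half_le (μ := volume.restrict B) (b := 15 ^ n * a)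
    (mul_ne_zero (by positivity) h0) (measurable_ballMaximal g) (ae_restrict_of_ae hfin) key
  refine this.trans (le_of_eq ?_)
  rw [Measure.restrict_apply_univ, ENNReal.mul_rpow_of_nonneg _ _ (by norm_num)]
  ring

lemma ae_ballMaximal_ne_top {n : ℕ} {g : (Fin n → ℝ) → ℝ≥0∞} (hg : ∫⁻ x, g x ≠ ∞) :
    ∀ᵐ x, ballMaximal g x ≠ ∞ := by
  set V := volume (Metric.closedBall (0 : Fin n → ℝ) 1) with hV
  have hV0 : V ≠ 0 := volume_closedBall_ne_zero _ one_pos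
  have hVt : V ≠ ∞ := volume_closedBall_ne_top _ _
  set E := {x | ballMaximal g x = ∞} with hE
  have hweak : ∀ k : ℕ, (k + V⁻¹ * ∫⁻ x, g x) * volume E ≤ 5 ^ n * ∫⁻ x, g x := by
    intro k
    rw [← setLIntegral_univ]
    refine le_of_exists_closedBall (R := 1) fun y hy => ?_
    have hT : k + V⁻¹ * ∫⁻ x, g x < ballMaximal g y := by
      rw [show ballMaximal g y = ∞ from hy]
      finiteness
    rw [setLIntegral_univ]
    obtain ⟨c, ρ, hyρ, hlt⟩ := lt_ballMaximal_iff.1 hT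
    have hρ : 0 < ρ := Metric.pos_of_mem_ball hyρ
    refine ⟨c, ρ, hρ, ?_, Metric.ball_subset_closedBall hyρ, Set.subset_univ _, ?_⟩
    · by_contra! hρ1
      refine absurd hlt (not_lt.2 (le_add_left ?_))
      refine mul_le_mul' (ENNReal.inv_le_inv.2 ?_) (setLIntegral_le_lintegral _ _)
      rw [hV, ← Measure.addHaar_closedBall_center _ c]
      exact measure_mono (Metric.closedBall_subset_closedBall hρ1.le)
    · have := hlt.le
      rwa [mul_comm (volume (Metric.closedBall c ρ))⁻¹, ← div_eq_mul_inv,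
        ENNReal.le_div_iff_mul_le (Or.inl (volume_closedBall_ne_zero c hρ))
        (Or.inl (volume_closedBall_ne_top c ρ))] at this
  rw [ae_iff]
  simp only [ne_eq, not_not]
  by_contra hE0
  obtain ⟨k, hk⟩ := ENNReal.exists_nat_mul_gt (a := volume E) (b := 5 ^ n * ∫⁻ x, g x) hE0
    (by finiteness)
  refine absurd (hweak k) (not_le.2 (hk.trans_le ?_))
  gcongr
  exact le_self_add

lemma ae_le_ballMaximal {n : ℕ} {g : (Fin n → ℝ) → ℝ≥0∞} (hgm : Measurable g)
    (hg : ∫⁻ x, g x ≠ ∞) : ∀ᵐ x, g x ≤ ballMaximal g x := by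
  filter_upwards [VitaliFamily.ae_tendsto_lintegral_div
    (Besicovitch.vitaliFamily (volume : Measure (Fin n → ℝ))) hgm.aemeasurable hg] with x hx
  refine le_of_tendsto (hx.comp (Besicovitch.tendsto_filterAt volume x)) ?_
  filter_upwards [self_mem_nhdsWithin] with r hr
  rw [Function.comp_apply, div_eq_mul_inv, mul_comm]
  exact le_iSup₂_of_le x r (le_iSup_of_le (Metric.mem_ball_self hr) le_rfl)

lemma IsCube.exists_eq_closedBall {n : ℕ} {S : Set (Fin n → ℝ)} (hS : IsCube S) :
    ∃ c r, 0 < r ∧ S = Metric.closedBall c r := by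
  obtain ⟨a, l, hl, rfl⟩ := hS
  refine ⟨fun i => a i + l / 2, l / 2, by positivity, ?_⟩
  rw [closedBall_pi _ (by positivity)]
  simp only [Real.closedBall_eq_Icc, add_sub_cancel_right, add_assoc, add_halves]

lemma IsCube.volume_ne_zero {n : ℕ} {S : Set (Fin n → ℝ)} (hS : IsCube S) : volume S ≠ 0 := by
  obtain ⟨c, r, hr, rfl⟩ := hS.exists_eq_closedBall
  exact volume_closedBall_ne_zero c hr

lemma IsCube.volume_ne_top {n : ℕ} {S : Set (Fin n → ℝ)} (hS : IsCube S) : volume S ≠ ∞ := by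
  obtain ⟨c, r, hr, rfl⟩ := hS.exists_eq_closedBall
  exact volume_closedBall_ne_top c r

lemma IsCube.measurableSet {n : ℕ} {S : Set (Fin n → ℝ)} (hS : IsCube S) : MeasurableSet S := by
  obtain ⟨c, r, hr, rfl⟩ := hS.exists_eq_closedBall
  exact measurableSet_closedBall

lemma MemLeb.hasApPowMajorant {n : ℕ} {Q : Set (Fin n → ℝ)} (hQ : IsCube Q) {p : ℝ} (hp : 0 < p)
    {f : (Fin n → ℝ) → ℝ} (hf : MemLeb Q p f) : HasApPowMajorant Q 1 (p / 2) f := by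
  obtain ⟨hfm, hfi⟩ := hf
  obtain ⟨K, hK, hmain⟩ := exists_setLIntegral_ballMaximal_rpow_half_le n
  set g : (Fin n → ℝ) → ℝ≥0∞ := Q.indicator fun x => ENNReal.ofReal |f x| ^ p + 1 with hg
  have hgm : Measurable g := by
    refine Measurable.indicator ?_ hQ.measurableSet
    fun_prop
  have hgi : ∫⁻ x, g x ≠ ∞ := by
    rw [hg, lintegral_indicator hQ.measurableSet, lintegral_add_right _ measurable_const]
    refine ENNReal.add_ne_top.2 ⟨by simpa using hfi.ne, ?_⟩
    simpa using hQ.volume_ne_top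
  have hfin := ae_ballMaximal_ne_top hgi
  have hle := ae_le_ballMaximal hgm hgi
  set w : (Fin n → ℝ) → ℝ := fun x => (ballMaximal g x ^ (1 / 2 : ℝ)).toReal with hw
  have hone : ∀ᵐ x ∂volume.restrict Q, ENNReal.ofReal |f x| ^ p + 1 ≤ ballMaximal g x := by
    rw [ae_restrict_iff' hQ.measurableSet]
    filter_upwards [hle] with x hx hxQ
    simpa [hg, hxQ] using hx
  have hwm : Measurable w := ((measurable_ballMaximal g).pow_const _).ennreal_toReal
  have hwof : ∀ᵐ x, ENNReal.ofReal (w x) = ballMaximal g x ^ (1 / 2 : ℝ) := by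
    filter_upwards [hfin] with x hx
    exact ENNReal.ofReal_toReal (by finiteness)
  have havg : ∀ᵐ x ∂volume.restrict Q, ∀ S, IsCube S → S ⊆ Q → x ∈ S →
      ∫⁻ y in S, ENNReal.ofReal |w y| ≤ volume S * ENNReal.ofReal (K.toReal * w x) := by
    filter_upwards [hone, ae_restrict_of_ae hwof] with x hx hwx S hS _ hxS
    obtain ⟨c, r, hr, rfl⟩ := hS.exists_eq_closedBall
    rw [ENNReal.ofReal_mul ENNReal.toReal_nonneg, ENNReal.ofReal_toReal hK, hwx]
    refine le_trans (lintegral_mono fun y => ?_) (hmain g c x r hr hxS ?_ hfin)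
    · rw [abs_of_nonneg ENNReal.toReal_nonneg]
      exact ENNReal.ofReal_toReal_le
    · exact (zero_lt_one.trans_le (le_add_self.trans hx)).ne'
  refine ⟨hfm, w, Or.inl ⟨rfl, ⟨hwm, ?_, fun S hS hSQ => ?_⟩, K.toReal, ?_⟩, ?_⟩
  · filter_upwards [hone, ae_restrict_of_ae hfin] with x hx hxt
    refine ENNReal.toReal_pos ?_ (by finiteness)
    exact (ENNReal.rpow_pos (zero_lt_one.trans_le (le_add_self.trans hx)) hxt).ne'
  · refine ⟨hwm.aestronglyMeasurable, ?_⟩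
    have h2 : ∀ᵐ x ∂volume.restrict S, x ∈ S := ae_restrict_mem hS.measurableSet
    have : (ae (volume.restrict S)).NeBot := by
      rw [ae_neBot, ne_eq, Measure.restrict_eq_zero]
      exact hS.volume_ne_zero
    obtain ⟨x, hx, hxS⟩ := ((ae_restrict_of_ae_restrict_of_subset hSQ havg).and h2).exists
    rw [hasFiniteIntegral_iff_norm]
    exact (hx S hS hSQ hxS).trans_lt (ENNReal.mul_lt_top hS.volume_ne_top.lt_top
      ENNReal.ofReal_lt_top)
  · filter_upwards [havg] with x hx
    refine iSup_le fun S => iSup_le fun hS => iSup_le fun hSQ => iSup_le fun hxS => ?_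
    rw [ENNReal.inv_mul_le_iff hS.volume_ne_zero hS.volume_ne_top]
    exact hx S hS hSQ hxS
  · filter_upwards [hone, ae_restrict_of_ae hfin] with x hx hxt
    have h1 := ENNReal.rpow_le_rpow (le_self_add.trans hx) (by norm_num : (0 : ℝ) ≤ 1 / 2)
    rw [← ENNReal.rpow_mul, ENNReal.ofReal_rpow_of_nonneg (abs_nonneg _) (by positivity),
      mul_one_div] at h1
    exact (ENNReal.ofReal_le_iff_le_toReal (by finiteness)).1 h1

lemma IsWeight.setLIntegral_ne_zero {n : ℕ} {Q S : Set (Fin n → ℝ)} {w : (Fin n → ℝ) → ℝ}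
    (hw : IsWeight Q w) (hS : IsCube S) (hSQ : S ⊆ Q) :
    ∫⁻ x in S, ENNReal.ofReal (w x) ≠ 0 := by
  intro h
  rw [lintegral_eq_zero_iff hw.measurable.ennreal_ofReal] at h
  have hpos := ae_restrict_of_ae_restrict_of_subset hSQ hw.pos
  have : (ae (volume.restrict S)).NeBot := by
    rw [ae_neBot, ne_eq, Measure.restrict_eq_zero]
    exact hS.volume_ne_zero
  obtain ⟨x, hx, hx0⟩ := (h.and hpos).exists
  exact (ENNReal.ofReal_pos.2 hx0).ne' hx

lemma IsWeight.setLIntegral_ne_top {n : ℕ} {Q S : Set (Fin n → ℝ)} {w : (Fin n → ℝ) → ℝ}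
    (hw : IsWeight Q w) (hS : IsCube S) (hSQ : S ⊆ Q) :
    ∫⁻ x in S, ENNReal.ofReal (w x) ≠ ∞ :=
  ((lintegral_mono fun _ => ENNReal.ofReal_le_ofReal (le_abs_self _)).trans_lt
    (hasFiniteIntegral_iff_norm _ |>.1 (hw.locInt S hS hSQ).2)).ne

/-- On each cube, an `A₁` weight is bounded below by a multiple of its average. -/
lemma MemA1.exists_average_le {n : ℕ} {Q : Set (Fin n → ℝ)} {w : (Fin n → ℝ) → ℝ}
    (hw : MemA1 Q w) : ∃ C : ℝ, 0 < C ∧ ∀ S, IsCube S → S ⊆ Q → ∃ m : ℝ, 0 < m ∧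
      (volume S)⁻¹ * ∫⁻ x in S, ENNReal.ofReal (w x) = ENNReal.ofReal m ∧
      ∀ᵐ x ∂volume.restrict S, m / C ≤ w x := by
  obtain ⟨hwt, C, hC⟩ := hw
  refine ⟨max C 1, by positivity, fun S hS hSQ => ?_⟩
  set A := (volume S)⁻¹ * ∫⁻ x in S, ENNReal.ofReal (w x) with hA
  have hA0 : A ≠ 0 := mul_ne_zero (ENNReal.inv_ne_zero.2 hS.volume_ne_top)
    (hwt.setLIntegral_ne_zero hS hSQ)
  have hAt : A ≠ ∞ := ENNReal.mul_ne_top (ENNReal.inv_ne_top.2 hS.volume_ne_zero)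
    (hwt.setLIntegral_ne_top hS hSQ)
  refine ⟨A.toReal, ENNReal.toReal_pos hA0 hAt, (ENNReal.ofReal_toReal hAt).symm, ?_⟩
  filter_upwards [ae_restrict_of_ae_restrict_of_subset hSQ hC,
    ae_restrict_of_ae_restrict_of_subset hSQ hwt.pos, ae_restrict_mem hS.measurableSet]
    with x hx hpos hxS
  rw [div_le_iff₀ (by positivity)]
  refine ENNReal.toReal_le_of_le_ofReal (by positivity) ?_
  calc A ≤ (volume S)⁻¹ * ∫⁻ y in S, ENNReal.ofReal |w y| :=
        mul_le_mul' le_rfl (lintegral_mono fun _ => ENNReal.ofReal_le_ofReal (le_abs_self _))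
    _ ≤ maximal Q w x := le_iSup₂_of_le S hS (le_iSup₂_of_le hSQ hxS le_rfl)
    _ ≤ _ := hx
    _ ≤ _ := by
        rw [mul_comm]
        gcongr
        exact le_max_left _ _

lemma MemA1.memApGT1_rpow_neg {n : ℕ} {Q : Set (Fin n → ℝ)} {v : (Fin n → ℝ) → ℝ}
    (hv : MemA1 Q v) {s : ℝ} (hs : 0 < s) : MemApGT1 Q (1 + s) fun x => v x ^ (-s) := by
  obtain ⟨C, hC, hmain⟩ := hv.exists_average_le
  have hub : ∀ S, IsCube S → S ⊆ Q → ∃ m : ℝ, 0 < m ∧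
      (volume S)⁻¹ * ∫⁻ x in S, ENNReal.ofReal (v x) = ENNReal.ofReal m ∧
      ∀ᵐ x ∂volume.restrict S, v x ^ (-s) ≤ (m / C) ^ (-s) := by
    intro S hS hSQ
    obtain ⟨m, hm, heq, hle⟩ := hmain S hS hSQ
    refine ⟨m, hm, heq, hle.mono fun x hx => ?_⟩
    exact Real.rpow_le_rpow_of_nonpos (by positivity) hx (by linarith)
  refine ⟨⟨hv.1.measurable.pow_const _, hv.1.pos.mono fun x hx => Real.rpow_pos_of_pos hx _,
    fun S hS hSQ => ?_⟩, ENNReal.ofReal (C ^ s), ENNReal.ofReal_ne_top, fun S hS hSQ => ?_⟩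
  · obtain ⟨m, hm, -, hle⟩ := hub S hS hSQ
    refine Measure.integrableOn_of_bounded (M := (m / C) ^ (-s)) hS.volume_ne_top
      (hv.1.measurable.pow_const _).aestronglyMeasurable ?_
    filter_upwards [hle, ae_restrict_of_ae_restrict_of_subset hSQ hv.1.pos] with x hx hpos
    rwa [Real.norm_of_nonneg (by positivity)]
  · obtain ⟨m, hm, heq, hle⟩ := hub S hS hSQ
    have h1 : (volume S)⁻¹ * ∫⁻ x in S, ENNReal.ofReal (v x ^ (-s)) ≤
        ENNReal.ofReal ((m / C) ^ (-s)) := by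
      rw [ENNReal.inv_mul_le_iff hS.volume_ne_zero hS.volume_ne_top, mul_comm, ← setLIntegral_const]
      exact lintegral_mono_ae (hle.mono fun x hx => ENNReal.ofReal_le_ofReal hx)
    have h2 : ∫⁻ x in S, ENNReal.ofReal ((v x ^ (-s)) ^ (1 - (1 + s) / (1 + s - 1))) =
        ∫⁻ x in S, ENNReal.ofReal (v x) := by
      refine lintegral_congr_ae ?_
      filter_upwards [ae_restrict_of_ae_restrict_of_subset hSQ hv.1.pos] with x hpos
      rw [← Real.rpow_mul hpos.le, show -s * (1 - (1 + s) / (1 + s - 1)) = 1 by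
        rw [add_sub_cancel_left]; field_simp; ring, Real.rpow_one]
    rw [h2, heq, add_sub_cancel_left, ENNReal.ofReal_rpow_of_pos hm]
    refine (mul_le_mul_left h1 _).trans ?_
    rw [← ENNReal.ofReal_mul (by positivity), Real.rpow_neg (by positivity),
      Real.div_rpow hm.le hC.le, inv_div, div_mul_cancel₀ _ (by positivity)]

lemma HasApPowMajorant.memLeb {n : ℕ} {Q : Set (Fin n → ℝ)} (hQ : IsCube Q) {r : ℝ} (hr : 0 < r)
    {f : (Fin n → ℝ) → ℝ} (hf : HasApPowMajorant Q 1 r f) : MemLeb Q r f := by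
  obtain ⟨hfm, w, ⟨-, hw⟩ | ⟨h, -⟩, hle⟩ := hf
  · refine ⟨hfm, lt_of_le_of_lt ?_ (hw.1.setLIntegral_ne_top hQ subset_rfl).lt_top⟩
    refine lintegral_mono_ae (hle.mono fun x hx => ?_)
    rw [ENNReal.ofReal_rpow_of_nonneg (abs_nonneg _) hr.le]
    simpa using ENNReal.ofReal_le_ofReal hx
  · exact absurd h (lt_irrefl _)

lemma HasApPowMajorant.exists_memLw {n : ℕ} {Q : Set (Fin n → ℝ)} (hQ : IsCube Q) {r p₀ : ℝ}
    (hr : 0 < r) (hp₀ : 0 < p₀) {f : (Fin n → ℝ) → ℝ} (hf : HasApPowMajorant Q 1 r f) :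
    ∃ w, MemAInf Q w ∧ MemLw Q p₀ w f := by
  obtain ⟨hfm, v, ⟨-, hv⟩ | ⟨h, -⟩, hle⟩ := hf
  · have hs : 0 < p₀ / r := by positivity
    refine ⟨fun x => v x ^ (-(p₀ / r)), ⟨1 + p₀ / r, by linarith, Or.inr ⟨by linarith,
      hv.memApGT1_rpow_neg hs⟩⟩, hfm, ?_⟩
    calc ∫⁻ x in Q, ENNReal.ofReal |f x| ^ p₀ * ENNReal.ofReal (v x ^ (-(p₀ / r)))
        ≤ ∫⁻ _ in Q, 1 := by
          refine lintegral_mono_ae ?_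
          filter_upwards [hle, hv.1.pos] with x hx hpos
          rw [ENNReal.ofReal_rpow_of_nonneg (abs_nonneg _) hp₀.le,
            ← ENNReal.ofReal_mul (by positivity), ENNReal.ofReal_le_one, Real.rpow_neg hpos.le,
            ← div_eq_mul_inv, div_le_one (by positivity)]
          calc |f x| ^ p₀ = (|f x| ^ r) ^ (p₀ / r) := by
                rw [← Real.rpow_mul (abs_nonneg _), mul_div_cancel₀ _ hr.ne']
            _ ≤ _ := Real.rpow_le_rpow (by positivity) hx hs.le
      _ < ∞ := by simpa using hQ.volume_ne_top.lt_top
  · exact absurd h (lt_irrefl _)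

lemma rpow_div_le_mul_add_rpow {t w p q : ℝ} (ht : 0 ≤ t) (hw : 0 < w) (hq : 1 < q) :
    t ^ (p / q) ≤ t ^ p * w + w ^ (1 - q / (q - 1)) := by
  have hq1 : 0 < q - 1 := by linarith
  have he : 1 - q / (q - 1) = -(1 / (q - 1)) := by field_simp; ring
  set u := t ^ (p / q) with hu
  have hu0 : 0 ≤ u := by positivity
  have hup : t ^ p = u ^ q := by
    rw [hu, ← Real.rpow_mul ht, div_mul_cancel₀ _ (by linarith)]
  rw [he, hup]
  rcases le_total u (w ^ (-(1 / (q - 1)))) with h | h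
  · have : 0 ≤ u ^ q * w := by positivity
    linarith
  · have hwp : 0 < w ^ (-(1 / (q - 1))) := by positivity
    have hupos : 0 < u := hwp.trans_le h
    have h1 := Real.rpow_le_rpow hwp.le h hq1.le
    rw [← Real.rpow_mul hw.le, show -(1 / (q - 1)) * (q - 1) = -1 by field_simp,
      Real.rpow_neg_one] at h1
    have h2 : u ^ q = u * u ^ (q - 1) := by
      rw [← Real.rpow_one_add' hu0 (by linarith)]
      congr 1
      ring
    have h3 : 1 ≤ u ^ (q - 1) * w := by
      calc 1 = w⁻¹ * w := (inv_mul_cancel₀ hw.ne').symm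
        _ ≤ _ := by gcongr
    have h4 : u * 1 ≤ u * (u ^ (q - 1) * w) := by gcongr
    rw [h2]
    linarith

lemma MemLw.exists_memLeb {n : ℕ} {Q : Set (Fin n → ℝ)} (hQ : IsCube Q) {p₀ : ℝ} (hp₀ : 0 < p₀)
    {w f : (Fin n → ℝ) → ℝ} (hw : MemAInf Q w) (hf : MemLw Q p₀ w f) :
    ∃ p, 0 < p ∧ MemLeb Q p f := by
  obtain ⟨hfm, hfi⟩ := hf
  obtain ⟨q, -, ⟨-, hw⟩ | ⟨hq, hwt, C, hC, hA⟩⟩ := hw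
  · obtain ⟨C, hC, hmain⟩ := hw.exists_average_le
    obtain ⟨m, hm, -, hle⟩ := hmain Q hQ subset_rfl
    refine ⟨p₀, hp₀, hfm, ?_⟩
    calc ∫⁻ x in Q, ENNReal.ofReal |f x| ^ p₀ * ENNReal.ofReal 1
        ≤ ∫⁻ x in Q, ENNReal.ofReal (C / m) *
            (ENNReal.ofReal |f x| ^ p₀ * ENNReal.ofReal (w x)) := by
          refine lintegral_mono_ae (hle.mono fun x hx => ?_)
          rw [mul_left_comm, ← ENNReal.ofReal_mul (by positivity)]
          gcongr
          calc 1 = C / m * (m / C) := by field_simp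
            _ ≤ _ := by gcongr
      _ = ENNReal.ofReal (C / m) *
            ∫⁻ x in Q, ENNReal.ofReal |f x| ^ p₀ * ENNReal.ofReal (w x) :=
          lintegral_const_mul' _ _ ENNReal.ofReal_ne_top
      _ < ∞ := ENNReal.mul_lt_top ENNReal.ofReal_lt_top hfi
  · have hdual : ∫⁻ x in Q, ENNReal.ofReal (w x ^ (1 - q / (q - 1))) < ∞ := by
      by_contra! htop
      have h := hA Q hQ subset_rfl
      rw [top_le_iff.1 htop, ENNReal.mul_top (ENNReal.inv_ne_zero.2 hQ.volume_ne_top),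
        ENNReal.top_rpow_of_pos (by linarith), ENNReal.mul_top (mul_ne_zero
          (ENNReal.inv_ne_zero.2 hQ.volume_ne_top) (hwt.setLIntegral_ne_zero hQ subset_rfl))] at h
      exact hC (top_le_iff.1 h)
    have hpq : 0 < p₀ / q := by positivity
    refine ⟨p₀ / q, hpq, hfm, ?_⟩
    calc ∫⁻ x in Q, ENNReal.ofReal |f x| ^ (p₀ / q) * ENNReal.ofReal 1
        ≤ ∫⁻ x in Q, ENNReal.ofReal |f x| ^ p₀ * ENNReal.ofReal (w x) +
            ENNReal.ofReal (w x ^ (1 - q / (q - 1))) := by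
          refine lintegral_mono_ae (hwt.pos.mono fun x hx => ?_)
          rw [ENNReal.ofReal_rpow_of_nonneg (abs_nonneg _) hpq.le,
            ENNReal.ofReal_rpow_of_nonneg (abs_nonneg _) hp₀.le, ENNReal.ofReal_one, mul_one,
            ← ENNReal.ofReal_mul (by positivity), ← ENNReal.ofReal_add (by positivity)
              (by positivity)]
          exact ENNReal.ofReal_le_ofReal (rpow_div_le_mul_add_rpow (abs_nonneg _) hx hq)
      _ = _ := lintegral_add_right _ (hwt.measurable.pow_const _).ennreal_ofReal
      _ < ∞ := ENNReal.add_lt_top.2 ⟨hfi, hdual⟩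

theorem stmt2 (n : ℕ) (Q : Set (Fin n → ℝ)) (hQ : IsCube Q) (p₀ : ℝ) (hp₀ : 0 < p₀) :
    {f : (Fin n → ℝ) → ℝ | ∃ r, 0 < r ∧ HasApPowMajorant Q 1 r f} =
      {f | ∃ p, 0 < p ∧ MemLeb Q p f} ∧
    {f : (Fin n → ℝ) → ℝ | ∃ p, 0 < p ∧ MemLeb Q p f} =
      {f | ∃ w, MemAInf Q w ∧ MemLw Q p₀ w f} := by
  refine ⟨Set.Subset.antisymm ?_ ?_, Set.Subset.antisymm ?_ ?_⟩
  · rintro f ⟨r, hr, hf⟩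
    exact ⟨r, hr, hf.memLeb hQ hr⟩
  · rintro f ⟨p, hp, hf⟩
    exact ⟨p / 2, by positivity, hf.hasApPowMajorant hQ hp⟩
  · rintro f ⟨p, hp, hf⟩
    exact (hf.hasApPowMajorant hQ hp).exists_memLw hQ (by positivity) hp₀
  · rintro f ⟨w, hw, hf⟩
    exact hf.exists_memLeb hQ hp₀ hw
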